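/- Fix a real number α ≥ 1. For every δ > 0 there exist ε with 0 < ε < 1/α and a threshold N₀ such that for every even integer N ≥ N₀ and every real z with N^{1/α − ε} < z ≤ N^{1/α}, one has | W_N(z) · (log N) / (2 α e^{−γ} C(N)) − 1 | ≤ δ, where γ is the Euler–Mascheroni constant. -/

import Mathlib

/-- `C(N) = (∏_{p ∣ N, p > 2} (p−1)/(p−2)) · (∏_{p > 2} (1 − 1/(p−1)²))`,
both products over primes. -/
noncomputable def CN (N : ℕ) : ℝ :=
  (∏ p ∈ N.primeFactors.filter (fun p => 2 < p), ((p : ℝ) - 1) / ((p : ℝ) - 2)) *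
    ∏' p : {p : ℕ // p.Prime ∧ 2 < p}, (1 - 1 / (((p : ℕ) : ℝ) - 1) ^ 2)

/-- The sieve product `W_N(z) = ∏_{p < z, p ∤ N} (1 − 1/(p−1))`, over primes `p`. -/
noncomputable def WN (N : ℕ) (z : ℝ) : ℝ :=
  ∏ᶠ p ∈ {p : ℕ | p.Prime ∧ (p : ℝ) < z ∧ ¬ p ∣ N}, (1 - 1 / ((p : ℝ) - 1))

open Filter Topology

/-- A discrete positive measure on the half line whose Laplace transform is `-log σ + o(1)`. -/
structure LapMeas {ι : Type} (a u : ι → ℝ) : Prop where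
  a_nonneg : ∀ i, 0 ≤ a i
  u_nonneg : ∀ i, 0 ≤ u i
  summ : ∀ σ : ℝ, 0 < σ → Summable (fun i => a i * Real.exp (-(σ * u i)))
  tend : Tendsto (fun σ : ℝ => (∑' i, a i * Real.exp (-(σ * u i))) + Real.log σ) (𝓝[>] 0) (𝓝 0)

noncomputable def LS {ι : Type} (a u : ι → ℝ) (f : ℝ → ℝ) (σ : ℝ) : ℝ :=
  ∑' i, a i * f (Real.exp (-(σ * u i)))

noncomputable def LTr {ι : Type} (a u : ι → ℝ) (X : ℝ) : ℝ :=
  ∑' i, if u i < X then a i else 0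

section Taub
variable {ι : Type} {a u : ι → ℝ}

lemma LapMeas.mem (H : LapMeas a u) {σ : ℝ} (hσ : 0 < σ) (i : ι) :
    Real.exp (-(σ * u i)) ∈ Set.Icc (0 : ℝ) 1 := by
  refine ⟨(Real.exp_pos _).le, ?_⟩
  rw [Real.exp_le_one_iff]
  have := mul_nonneg hσ.le (H.u_nonneg i)
  linarith

lemma LapMeas.summable_of_bound (H : LapMeas a u) {f : ℝ → ℝ} {C : ℝ}
    (hf : ∀ x ∈ Set.Icc (0 : ℝ) 1, |f x| ≤ C * x) {σ : ℝ} (hσ : 0 < σ) :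
    Summable (fun i => a i * f (Real.exp (-(σ * u i)))) := by
  refine Summable.of_norm_bounded ((H.summ σ hσ).mul_left C) fun i => ?_
  rw [norm_mul, Real.norm_eq_abs, Real.norm_eq_abs, abs_of_nonneg (H.a_nonneg i)]
  have := mul_le_mul_of_nonneg_left (hf _ (H.mem hσ i)) (H.a_nonneg i)
  linarith

lemma bound_of_cont {h : ℝ → ℝ} (hh : ContinuousOn h (Set.Icc 0 1)) :
    ∃ C, ∀ x ∈ Set.Icc (0 : ℝ) 1, |x * h x| ≤ C * x := by
  obtain ⟨C, hC⟩ := isCompact_Icc.exists_bound_of_continuousOn hh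
  refine ⟨C, fun x hx => ?_⟩
  rw [abs_mul, abs_of_nonneg hx.1, mul_comm]
  exact mul_le_mul_of_nonneg_right (hC x hx) hx.1

lemma LapMeas.summable_cont (H : LapMeas a u) {h : ℝ → ℝ} (hh : ContinuousOn h (Set.Icc 0 1))
    {σ : ℝ} (hσ : 0 < σ) :
    Summable (fun i => a i * (Real.exp (-(σ * u i)) * h (Real.exp (-(σ * u i))))) := by
  obtain ⟨C, hC⟩ := bound_of_cont hh
  exact H.summable_of_bound (f := fun x => x * h x) hC hσ

variable {κ : Type} {b v : κ → ℝ}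

lemma tendsto_scale {c : ℝ} (hc : 0 < c) :
    Tendsto (fun σ : ℝ => c * σ) (𝓝[>] 0) (𝓝[>] 0) := by
  refine tendsto_nhdsWithin_iff.2 ⟨?_, ?_⟩
  · have : Tendsto (fun σ : ℝ => c * σ) (𝓝 0) (𝓝 (c * 0)) := (continuous_const_mul c).tendsto 0
    rw [mul_zero] at this
    exact this.mono_left nhdsWithin_le_nhds
  · filter_upwards [self_mem_nhdsWithin] with σ hσ
    exact mul_pos hc hσ

lemma LapMeas.tend_poly (H : LapMeas a u) (K : LapMeas b v) (Q : Polynomial ℝ) :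
    Tendsto (fun σ => LS a u (fun x => x * Q.eval x) σ - LS b v (fun x => x * Q.eval x) σ)
      (𝓝[>] 0) (𝓝 0) := by
  induction Q using Polynomial.induction_on' with
  | add p q hp hq =>
    have := hp.add hq
    rw [add_zero] at this
    refine this.congr' ?_
    filter_upwards [self_mem_nhdsWithin] with σ hσ
    simp only [LS, Polynomial.eval_add, mul_add]
    rw [(H.summable_cont p.continuous.continuousOn hσ).tsum_add
      (H.summable_cont q.continuous.continuousOn hσ),
      (K.summable_cont p.continuous.continuousOn hσ).tsum_add
      (K.summable_cont q.continuous.continuousOn hσ)]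
    ring
  | monomial n c =>
    have h1 := ((H.tend.sub K.tend).comp (tendsto_scale (c := (n : ℝ) + 1) (by positivity))).const_mul c
    simp only [sub_zero, mul_zero] at h1
    refine h1.congr fun σ => ?_
    have key : ∀ t : ℝ, c * Real.exp (-(((n : ℝ) + 1) * σ * t)) = Real.exp (-(σ * t)) * (c * Real.exp (-(σ * t)) ^ n) := by
      intro t
      rw [show -(((n : ℝ) + 1) * σ * t) = ((n + 1 : ℕ) : ℝ) * (-(σ * t)) by push_cast; ring,
        Real.exp_nat_mul]
      ring
    simp only [LS, Polynomial.eval_monomial, Function.comp, ← key]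
    simp only [mul_left_comm _ c, tsum_mul_left]
    ring

lemma LapMeas.small (H : LapMeas a u) :
    ∀ᶠ σ in 𝓝[>] (0 : ℝ), LS a u (fun x => x * (1 - x)) σ < 1 := by
  have h := H.tend.sub (H.tend.comp (tendsto_scale (c := 2) (by norm_num)))
  have h2 := h.add_const (Real.log 2)
  have h3 : (0 : ℝ) - 0 + Real.log 2 < 1 := by
    have := Real.log_two_lt_d9; norm_num at *; linarith
  filter_upwards [h2.eventually_lt_const h3, self_mem_nhdsWithin] with σ hσ hpos
  have hpos : 0 < σ := hpos
  have e : LS a u (fun x => x * (1 - x)) σ = (∑' i, a i * Real.exp (-(σ * u i))) -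
      (∑' i, a i * Real.exp (-(2 * σ * u i))) := by
    rw [← (H.summ σ hpos).tsum_sub (H.summ (2 * σ) (by positivity))]
    refine tsum_congr fun i => ?_
    rw [show -(2 * σ * u i) = -(σ * u i) + -(σ * u i) by ring, Real.exp_add]
    ring
  simp only [Function.comp] at hσ
  rw [Real.log_mul (by norm_num) hpos.ne'] at hσ
  rw [e]
  linarith

lemma LapMeas.approx (H : LapMeas a u) {h : ℝ → ℝ} (hh : ContinuousOn h (Set.Icc 0 1))
    {Q : Polynomial ℝ} {τ : ℝ} (hQ : ∀ x ∈ Set.Icc (0 : ℝ) 1, |Q.eval x - h x| < τ)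
    {σ : ℝ} (hσ : 0 < σ) :
    |LS a u (fun x => x * (1 + (1 - Polynomial.X) * Q : Polynomial ℝ).eval x) σ -
      LS a u (fun x => x * (1 + (1 - x) * h x)) σ| ≤ τ * LS a u (fun x => x * (1 - x)) σ := by
  have hc : ContinuousOn (fun x => 1 + (1 - x) * h x) (Set.Icc 0 1) := by fun_prop
  have hs := H.summable_cont (h := fun x => 1 - x) (by fun_prop) hσ
  have e1 := H.summable_cont (1 + (1 - Polynomial.X) * Q : Polynomial ℝ).continuous.continuousOn hσ
  have e2 := H.summable_cont hc hσ
  unfold LS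
  rw [← e1.tsum_sub e2, ← tsum_mul_left, ← Real.norm_eq_abs]
  refine tsum_of_norm_bounded (hs.mul_left τ).hasSum fun i => ?_
  have hm := H.mem hσ i
  generalize Real.exp (-(σ * u i)) = x at hm
  have : a i * (x * (1 + (1 - Polynomial.X) * Q : Polynomial ℝ).eval x) -
      a i * (x * (1 + (1 - x) * h x)) = a i * (x * (1 - x)) * (Q.eval x - h x) := by
    simp; ring
  rw [this, Real.norm_eq_abs, abs_mul]
  have hn : 0 ≤ a i * (x * (1 - x)) :=
    mul_nonneg (H.a_nonneg i) (mul_nonneg hm.1 (by linarith [hm.2]))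
  rw [abs_of_nonneg hn, mul_comm]
  exact mul_le_mul_of_nonneg_right (hQ x hm).le hn

lemma LapMeas.tend_cont (H : LapMeas a u) (K : LapMeas b v) {h : ℝ → ℝ}
    (hh : ContinuousOn h (Set.Icc 0 1)) :
    Tendsto (fun σ => LS a u (fun x => x * (1 + (1 - x) * h x)) σ -
      LS b v (fun x => x * (1 + (1 - x) * h x)) σ) (𝓝[>] 0) (𝓝 0) := by
  rw [Metric.tendsto_nhds]
  intro η hη
  obtain ⟨Q, hQ⟩ := exists_polynomial_near_of_continuousOn 0 1 h hh (η / 4) (by positivity)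
  have hp := H.tend_poly K (1 + (1 - Polynomial.X) * Q)
  rw [Metric.tendsto_nhds] at hp
  filter_upwards [hp (η / 2) (by positivity), H.small, K.small, self_mem_nhdsWithin]
    with σ h1 h2 h3 hσ
  have a1 := H.approx hh hQ hσ
  have a2 := K.approx hh hQ hσ
  rw [Real.dist_eq, sub_zero] at *
  have b1 := mul_lt_mul_of_pos_left h2 (show 0 < η / 4 by positivity)
  have b2 := mul_lt_mul_of_pos_left h3 (show 0 < η / 4 by positivity)
  rw [abs_lt] at *
  rw [abs_le] at a1 a2
  constructor <;> linarith [a1.1, a1.2, a2.1, a2.2, h1.1, h1.2]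

/-- ramp -/
noncomputable def rampF (c d x : ℝ) : ℝ := max 0 (min 1 ((x - c) / (d - c)))

lemma rampF_nonneg (c d x : ℝ) : 0 ≤ rampF c d x := le_max_left _ _
lemma rampF_le_one (c d x : ℝ) : rampF c d x ≤ 1 := max_le zero_le_one (min_le_left _ _)
lemma rampF_eq_zero {c d x : ℝ} (h : c < d) (hx : x ≤ c) : rampF c d x = 0 := by
  refine max_eq_left ((min_le_right _ _).trans ?_)
  exact div_nonpos_of_nonpos_of_nonneg (by linarith) (by linarith)
lemma rampF_eq_one {c d x : ℝ} (h : c < d) (hx : d ≤ x) : rampF c d x = 1 := by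
  have : 1 ≤ (x - c) / (d - c) := by rw [le_div_iff₀ (by linarith)]; linarith
  rw [rampF, min_eq_left this, max_eq_right zero_le_one]

lemma rampF_rep {c d : ℝ} (hc : 0 < c) (h : c < d) (hd : d < 1) (x : ℝ) :
    x * (1 + (1 - x) * (rampF c d x / max x c - (1 - rampF c d x) / (1 - min x d))) =
      rampF c d x := by
  rcases le_or_gt x c with h1 | h1
  · rw [rampF_eq_zero h h1, min_eq_left (by linarith)]
    have : 1 - x ≠ 0 := by linarith
    field_simp
    ring
  · rcases le_or_gt d x with h2 | h2
    · rw [rampF_eq_one h h2, max_eq_left h1.le]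
      have : x ≠ 0 := by linarith
      field_simp
      ring
    · rw [max_eq_left h1.le, min_eq_left h2.le]
      have : x ≠ 0 := by linarith
      have : 1 - x ≠ 0 := by linarith
      field_simp
      ring

lemma LapMeas.tend_ramp (H : LapMeas a u) (K : LapMeas b v) {c d : ℝ} (hc : 0 < c) (h : c < d)
    (hd : d < 1) :
    Tendsto (fun σ => LS a u (rampF c d) σ - LS b v (rampF c d) σ) (𝓝[>] 0) (𝓝 0) := by
  have hcont : Continuous (fun x => rampF c d x / max x c - (1 - rampF c d x) / (1 - min x d)) := by
    have hr : Continuous (rampF c d) := by unfold rampF; fun_prop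
    refine (hr.div (by fun_prop) fun x => ?_).sub ((continuous_const.sub hr).div (by fun_prop) fun x => ?_)
    · exact (lt_of_lt_of_le hc (le_max_right _ _)).ne'
    · have := min_le_right x d
      linarith
  have := H.tend_cont K hcont.continuousOn
  simpa only [rampF_rep hc h hd] using this

lemma LapMeas.summable_LT (H : LapMeas a u) {X : ℝ} (hX : 0 < X) :
    Summable (fun i => if u i < X then a i else 0) := by
  refine Summable.of_nonneg_of_le (fun i => ?_) (fun i => ?_) ((H.summ X⁻¹ (by positivity)).mul_left (Real.exp 1))
  · split_ifs
    · exact H.a_nonneg i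
    · exact le_rfl
  · split_ifs with hi
    · have : 1 ≤ Real.exp (1 + -(X⁻¹ * u i)) := by
        rw [Real.one_le_exp_iff]
        have : X⁻¹ * u i ≤ 1 := by rw [inv_mul_le_iff₀ hX]; linarith
        linarith
      rw [Real.exp_add] at this
      have h2 := mul_le_mul_of_nonneg_left this (H.a_nonneg i)
      linarith
    · exact mul_nonneg (Real.exp_pos _).le (mul_nonneg (H.a_nonneg i) (Real.exp_pos _).le)

lemma LapMeas.sandwich (H : LapMeas a u) {q : ℝ} (hq : 1 < q) {X : ℝ} (hX : 0 < X) :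
    LTr a u X ≤ LS a u (rampF (Real.exp (-q)) (Real.exp (-1))) X⁻¹ ∧
    LS a u (rampF (Real.exp (-q)) (Real.exp (-1))) X⁻¹ ≤ LTr a u (q * X) := by
  have hcd : Real.exp (-q) < Real.exp (-1) := Real.exp_lt_exp.2 (by linarith)
  have hb : ∀ x ∈ Set.Icc (0 : ℝ) 1, |rampF (Real.exp (-q)) (Real.exp (-1)) x| ≤ (Real.exp q) * x := by
    intro x hx
    rw [abs_of_nonneg (rampF_nonneg _ _ _)]
    rcases le_or_gt x (Real.exp (-q)) with h | h
    · rw [rampF_eq_zero hcd h]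
      exact mul_nonneg (Real.exp_pos _).le hx.1
    · refine (rampF_le_one _ _ _).trans ?_
      have := mul_le_mul_of_nonneg_left h.le (Real.exp_pos q).le
      rwa [← Real.exp_add, add_neg_cancel, Real.exp_zero] at this
  have hs := H.summable_of_bound hb (inv_pos.2 hX)
  constructor
  · refine (H.summable_LT hX).tsum_le_tsum (fun i => ?_) hs
    split_ifs with hi
    · rw [rampF_eq_one hcd, mul_one]
      rw [Real.exp_le_exp, neg_le_neg_iff, inv_mul_le_iff₀ hX]
      linarith
    · exact mul_nonneg (H.a_nonneg i) (rampF_nonneg _ _ _)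
  · refine hs.tsum_le_tsum (fun i => ?_) (H.summable_LT (by positivity))
    split_ifs with hi
    · exact mul_le_of_le_one_right (H.a_nonneg i) (rampF_le_one _ _ _)
    · rw [rampF_eq_zero hcd, mul_zero]
      rw [Real.exp_le_exp, neg_le_neg_iff, le_inv_mul_iff₀ hX]
      linarith

lemma LapMeas.compare (H : LapMeas a u) (K : LapMeas b v) {q : ℝ} (hq : 1 < q) {η : ℝ}
    (hη : 0 < η) : ∀ᶠ X in atTop, LTr a u X ≤ LTr b v (q * X) + η := by
  have hcd : Real.exp (-q) < Real.exp (-1) := Real.exp_lt_exp.2 (by linarith)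
  have h := (H.tend_ramp K (Real.exp_pos (-q)) hcd (by rw [Real.exp_lt_one_iff]; norm_num)).comp
    tendsto_inv_atTop_nhdsGT_zero
  filter_upwards [h.eventually_lt_const hη, eventually_gt_atTop 0] with X h1 hX
  have a1 := (H.sandwich hq hX).1
  have a2 := (K.sandwich hq hX).2
  simp only [Function.comp] at h1
  linarith

theorem LapMeas.tauberian (H : LapMeas a u) (K : LapMeas b v) {g : ℝ}
    (hg : Tendsto (fun X => LTr b v X - Real.log X) atTop (𝓝 g)) :
    Tendsto (fun X => LTr a u X - Real.log X) atTop (𝓝 g) := by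
  rw [tendsto_order]
  have hlog : ∀ η : ℝ, 0 < η → 1 < Real.exp η := fun η hη => Real.one_lt_exp_iff.2 hη
  constructor
  · intro l hl
    set η := (g - l) / 3 with hη
    have hη0 : 0 < η := by rw [hη]; linarith
    have h1 := K.compare H (hlog η hη0) hη0
    have hsc : Tendsto (fun X : ℝ => Real.exp (-η) * X) atTop atTop :=
      tendsto_id.const_mul_atTop (Real.exp_pos _)
    filter_upwards [hsc.eventually h1, hsc.eventually (hg.eventually_const_lt (show g - η < g by linarith)),
      eventually_gt_atTop 0] with X a1 a2 hX
    rw [← mul_assoc, ← Real.exp_add, add_neg_cancel, Real.exp_zero, one_mul] at a1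
    rw [Real.log_mul (Real.exp_pos _).ne' hX.ne', Real.log_exp] at a2
    linarith
  · intro l hl
    set η := (l - g) / 3 with hη
    have hη0 : 0 < η := by rw [hη]; linarith
    have h1 := H.compare K (hlog η hη0) hη0
    have hsc : Tendsto (fun X : ℝ => Real.exp η * X) atTop atTop :=
      tendsto_id.const_mul_atTop (Real.exp_pos _)
    filter_upwards [h1, hsc.eventually (hg.eventually_lt_const (show g < g + η by linarith)),
      eventually_gt_atTop 0] with X a1 a2 hX
    rw [Real.log_mul (Real.exp_pos _).ne' hX.ne', Real.log_exp] at a2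
    linarith

end Taub

lemma harm_meas : LapMeas (fun k : ℕ => 1 / ((k : ℝ) + 1)) (fun k : ℕ => (k : ℝ) + 1) := by
  have key : ∀ σ : ℝ, 0 < σ → HasSum (fun k : ℕ => 1 / ((k : ℝ) + 1) * Real.exp (-(σ * ((k : ℝ) + 1))))
      (-Real.log (1 - Real.exp (-σ))) := by
    intro σ hσ
    have h1 : |Real.exp (-σ)| < 1 := by
      rw [abs_of_pos (Real.exp_pos _), Real.exp_lt_one_iff]; linarith
    refine (Real.hasSum_pow_div_log_of_abs_lt_one h1).congr_fun ?_ |> fun h => h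
    intro k
    rw [← Real.exp_nat_mul]
    push_cast
    rw [show ((k : ℝ) + 1) * -σ = -(σ * ((k : ℝ) + 1)) by ring]
    ring
  refine ⟨fun i => by positivity, fun i => by positivity, fun σ hσ => (key σ hσ).summable, ?_⟩
  have hd : HasDerivAt (fun s : ℝ => 1 - Real.exp (-s)) 1 0 := by
    have := ((hasDerivAt_neg (0 : ℝ)).exp).const_sub 1
    simpa using this
  have h2 := hd.tendsto_slope_zero_right
  have h3 := (h2.log one_ne_zero).neg
  rw [Real.log_one, neg_zero] at h3
  refine h3.congr' ?_
  filter_upwards [self_mem_nhdsWithin] with σ hσ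
  have hσ : 0 < σ := hσ
  have hp : 0 < 1 - Real.exp (-σ) := by
    have : Real.exp (-σ) < 1 := by rw [Real.exp_lt_one_iff]; linarith
    linarith
  rw [(key σ hσ).tsum_eq]
  simp only [zero_add, Real.exp_zero, sub_self, sub_zero, smul_eq_mul]
  rw [Real.log_mul (inv_ne_zero hσ.ne') hp.ne', Real.log_inv]
  ring

lemma harm_tend : Tendsto (fun X => LTr (fun k : ℕ => 1 / ((k : ℝ) + 1)) (fun k : ℕ => (k : ℝ) + 1) X
    - Real.log X) atTop (𝓝 Real.eulerMascheroniConstant) := by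
  have hc : Tendsto (fun X : ℝ => ⌈X⌉₊ - 1) atTop atTop :=
    (tendsto_sub_atTop_nat 1).comp tendsto_nat_ceil_atTop
  have h1 := Real.tendsto_harmonic_sub_log_add_one.comp hc
  have h2 := (tendsto_nat_ceil_div_atTop (R := ℝ)).log one_ne_zero
  have h3 := h1.add h2
  rw [Real.log_one, add_zero] at h3
  refine h3.congr' ?_
  filter_upwards [eventually_gt_atTop 0] with X hX
  have hpos : 0 < ⌈X⌉₊ := Nat.ceil_pos.2 hX
  have e1 : LTr (fun k : ℕ => 1 / ((k : ℝ) + 1)) (fun k : ℕ => (k : ℝ) + 1) X =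
      (harmonic (⌈X⌉₊ - 1) : ℝ) := by
    unfold LTr harmonic
    rw [tsum_eq_sum (s := Finset.range (⌈X⌉₊ - 1))]
    · push_cast
      refine Finset.sum_congr rfl fun k hk => ?_
      rw [Finset.mem_range] at hk
      have : k + 1 < ⌈X⌉₊ := by omega
      rw [Nat.lt_ceil] at this
      push_cast at this
      rw [if_pos this, one_div]
    · intro k hk
      rw [Finset.mem_range] at hk
      rw [if_neg]
      intro h
      have : k + 1 < ⌈X⌉₊ := by rw [Nat.lt_ceil]; push_cast; exact h
      omega
  have e2 : (((⌈X⌉₊ - 1 : ℕ) : ℝ) + 1) = (⌈X⌉₊ : ℝ) := by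
    rw [Nat.cast_sub hpos]; simp
  simp only [Function.comp]
  rw [e1, e2, Real.log_div (by positivity) hX.ne']
  ring

lemma ell_bound {y : ℝ} (h0 : 0 ≤ y) (h1 : y ≤ 1 / 2) :
    0 ≤ -Real.log (1 - y) - y ∧ -Real.log (1 - y) - y ≤ 2 * y ^ 2 := by
  have hp : 0 < 1 - y := by linarith
  constructor
  · have := Real.log_le_sub_one_of_pos hp; linarith
  · have := Real.one_sub_inv_le_log_of_pos hp
    have h2 : (1 - y)⁻¹ ≤ 1 + y + 2 * y ^ 2 := by
      rw [inv_le_iff_one_le_mul₀ hp]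
      nlinarith [mul_nonneg (sq_nonneg y) (by linarith : (0 : ℝ) ≤ 1 - 2 * y)]
    linarith

noncomputable def powHom (s : ℝ) (hs : s ≠ 0) : ℕ →*₀ ℝ where
  toFun n := (n : ℝ) ^ (-s)
  map_zero' := by simp [hs]
  map_one' := by simp
  map_mul' m n := by
    push_cast
    exact Real.mul_rpow (Nat.cast_nonneg m) (Nat.cast_nonneg n)

lemma prime_pow_le {p : Nat.Primes} {σ : ℝ} (hσ : 0 < σ) :
    0 < ((p : ℕ) : ℝ) ^ (-σ) ∧ ((p : ℕ) : ℝ) ^ (-σ) ≤ 1 := by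
  have hp : (2 : ℝ) ≤ ((p : ℕ) : ℝ) := by exact_mod_cast p.2.two_le
  refine ⟨Real.rpow_pos_of_pos (by linarith) _, ?_⟩
  exact Real.rpow_le_one_of_one_le_of_nonpos (by linarith) (by linarith)

lemma log_zeta {σ : ℝ} (hσ : 0 < σ) :
    0 < ∑' n : ℕ, 1 / (n : ℝ) ^ (1 + σ) ∧
    HasSum (fun p : Nat.Primes => -Real.log (1 - 1 / ((p : ℕ) : ℝ) * ((p : ℕ) : ℝ) ^ (-σ)))
      (Real.log (∑' n : ℕ, 1 / (n : ℝ) ^ (1 + σ))) := by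
  have hs : Summable (fun n : ℕ => 1 / (n : ℝ) ^ (1 + σ)) :=
    Real.summable_one_div_nat_rpow.2 (by linarith)
  have hpos : 0 < ∑' n : ℕ, 1 / (n : ℝ) ^ (1 + σ) := by
    refine hs.tsum_pos (fun n => by positivity) 1 (by simp)
  refine ⟨hpos, ?_⟩
  have hf : ∀ n : ℕ, powHom (1 + σ) (by linarith) n = 1 / (n : ℝ) ^ (1 + σ) := by
    intro n
    change (n : ℝ) ^ (-(1 + σ)) = _
    rw [Real.rpow_neg (Nat.cast_nonneg n), one_div]
  have hE := EulerProduct.eulerProduct_completely_multiplicative_hasProd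
    (f := powHom (1 + σ) (by linarith)) (by
      simp only [hf]
      exact hs.norm)
  simp only [hf] at hE
  have hl : Tendsto (fun s : Finset Nat.Primes => Real.log (∏ p ∈ s, (1 - 1 / ((p : ℕ) : ℝ) ^ (1 + σ))⁻¹))
      atTop (𝓝 (Real.log (∑' n : ℕ, 1 / (n : ℝ) ^ (1 + σ)))) :=
    Tendsto.log hE hpos.ne'
  change Tendsto _ _ _
  refine hl.congr fun s => ?_
  have hne : ∀ p : Nat.Primes, (1 - 1 / ((p : ℕ) : ℝ) ^ (1 + σ))⁻¹ ≠ 0 := by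
    intro p
    have hp : (1 : ℝ) < ((p : ℕ) : ℝ) := by exact_mod_cast p.2.one_lt
    have : 1 < ((p : ℕ) : ℝ) ^ (1 + σ) := Real.one_lt_rpow hp (by linarith)
    have h2 : 1 / ((p : ℕ) : ℝ) ^ (1 + σ) < 1 := by
      rw [div_lt_one (by linarith)]; exact this
    exact inv_ne_zero (by linarith)
  rw [Real.log_prod (fun p _ => hne p)]
  refine Finset.sum_congr rfl fun p _ => ?_
  have hp : (0 : ℝ) < ((p : ℕ) : ℝ) := by exact_mod_cast p.2.pos
  have e : 1 / ((p : ℕ) : ℝ) ^ (1 + σ) = 1 / ((p : ℕ) : ℝ) * ((p : ℕ) : ℝ) ^ (-σ) := by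
    rw [Real.rpow_add hp, Real.rpow_one, Real.rpow_neg hp.le, one_div, mul_inv, one_div]
  rw [Real.log_inv, e]

lemma prime_meas : LapMeas (fun p : Nat.Primes => -Real.log (1 - 1 / ((p : ℕ) : ℝ)))
    (fun p : Nat.Primes => Real.log ((p : ℕ) : ℝ)) := by
  have hp2 : ∀ p : Nat.Primes, (2 : ℝ) ≤ ((p : ℕ) : ℝ) := fun p => by exact_mod_cast p.2.two_le
  have hy : ∀ p : Nat.Primes, 0 ≤ 1 / ((p : ℕ) : ℝ) ∧ 1 / ((p : ℕ) : ℝ) ≤ 1 / 2 := fun p =>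
    ⟨by positivity, one_div_le_one_div_of_le (by norm_num) (hp2 p)⟩
  have hex : ∀ (σ : ℝ) (p : Nat.Primes), Real.exp (-(σ * Real.log ((p : ℕ) : ℝ))) =
      ((p : ℕ) : ℝ) ^ (-σ) := by
    intro σ p
    rw [Real.rpow_def_of_pos (by linarith [hp2 p])]
    congr 1; ring
  have hsum : ∀ σ : ℝ, 0 < σ → Summable (fun p : Nat.Primes =>
      -Real.log (1 - 1 / ((p : ℕ) : ℝ)) * ((p : ℕ) : ℝ) ^ (-σ)) := by
    intro σ hσ
    have h1 : Summable (fun p : Nat.Primes => ((p : ℕ) : ℝ) ^ (-1 - σ)) :=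
      Nat.Primes.summable_rpow.2 (by linarith)
    refine Summable.of_nonneg_of_le (fun p => ?_) (fun p => ?_) (h1.mul_left 2)
    · have := ell_bound (hy p).1 (hy p).2
      exact mul_nonneg (by linarith [(hy p).1]) (prime_pow_le hσ).1.le
    · have h3 := ell_bound (hy p).1 (hy p).2
      have hpos : (0 : ℝ) < ((p : ℕ) : ℝ) := by linarith [hp2 p]
      rw [sub_eq_add_neg (-1) σ, Real.rpow_add hpos, Real.rpow_neg_one, ← mul_assoc]
      refine mul_le_mul_of_nonneg_right ?_ (by positivity)
      rw [← one_div]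
      nlinarith [h3.2, (hy p).1, (hy p).2]
  refine ⟨fun p => ?_, fun p => Real.log_nonneg (by linarith [hp2 p]), ?_, ?_⟩
  · have := ell_bound (hy p).1 (hy p).2
    linarith [(hy p).1]
  · intro σ hσ
    simp only [hex]
    exact hsum σ hσ
  simp only [hex]
  have hz : Tendsto (fun σ : ℝ => Real.log (∑' n : ℕ, 1 / (n : ℝ) ^ (1 + σ)) + Real.log σ) (𝓝[>] 0) (𝓝 0) := by
    have ht : Tendsto (fun σ : ℝ => 1 + σ) (𝓝[>] 0) (𝓝[>] 1) := by
      refine tendsto_nhdsWithin_iff.2 ⟨?_, ?_⟩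
      · have : Tendsto (fun σ : ℝ => 1 + σ) (𝓝 0) (𝓝 (1 + 0)) := (continuous_const_add 1).tendsto 0
        rw [add_zero] at this
        exact this.mono_left nhdsWithin_le_nhds
      · filter_upwards [self_mem_nhdsWithin] with σ hσ
        have : 0 < σ := hσ
        change 1 < 1 + σ
        linarith
    have h := (tendsto_sub_mul_tsum_nat_rpow.comp ht).log one_ne_zero
    rw [Real.log_one] at h
    refine h.congr' ?_
    filter_upwards [self_mem_nhdsWithin] with σ hσ
    have hσ : 0 < σ := hσ
    simp only [Function.comp, add_sub_cancel_left]
    rw [Real.log_mul hσ.ne' (log_zeta hσ).1.ne', add_comm]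
  have hd : Tendsto (fun σ : ℝ => ∑' p : Nat.Primes, (-Real.log (1 - 1 / ((p : ℕ) : ℝ)) * ((p : ℕ) : ℝ) ^ (-σ)
      - -Real.log (1 - 1 / ((p : ℕ) : ℝ) * ((p : ℕ) : ℝ) ^ (-σ)))) (𝓝[>] 0) (𝓝 (∑' _p : Nat.Primes, (0 : ℝ))) := by
    have hb : Summable (fun p : Nat.Primes => 2 * ((p : ℕ) : ℝ) ^ (-2 : ℝ)) :=
      (Nat.Primes.summable_rpow.2 (by norm_num)).mul_left 2
    refine tendsto_tsum_of_dominated_convergence hb (fun p => ?_) ?_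
    · have hpos : (0 : ℝ) < ((p : ℕ) : ℝ) := by linarith [hp2 p]
      have ht : Tendsto (fun σ : ℝ => ((p : ℕ) : ℝ) ^ (-σ)) (𝓝[>] 0) (𝓝 1) := by
        have : Continuous (fun σ : ℝ => ((p : ℕ) : ℝ) ^ (-σ)) :=
          Real.continuous_const_rpow hpos.ne' |>.comp continuous_neg
        have h := this.tendsto 0
        simp only [neg_zero, Real.rpow_zero] at h
        exact h.mono_left nhdsWithin_le_nhds
      have hne : 1 - 1 / ((p : ℕ) : ℝ) * 1 ≠ 0 := by linarith [(hy p).2]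
      have := (ht.const_mul (-Real.log (1 - 1 / ((p : ℕ) : ℝ)))).sub
        ((((ht.const_mul (1 / ((p : ℕ) : ℝ))).const_sub 1).log hne).neg)
      simpa using this
    · filter_upwards [self_mem_nhdsWithin] with σ hσ p
      have ht := prime_pow_le (p := p) hσ
      have hpos : (0 : ℝ) < ((p : ℕ) : ℝ) := by linarith [hp2 p]
      have e : ((p : ℕ) : ℝ) ^ (-2 : ℝ) = (1 / ((p : ℕ) : ℝ)) ^ 2 := by
        rw [Real.rpow_neg hpos.le]; norm_num
      rw [e]
      have hyp := hy p
      generalize ((p : ℕ) : ℝ) ^ (-σ) = t at ht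
      generalize 1 / ((p : ℕ) : ℝ) = y at hyp
      have b1 := ell_bound hyp.1 hyp.2
      have hyt : y * t ≤ y := mul_le_of_le_one_right hyp.1 ht.2
      have hyt0 : 0 ≤ y * t := mul_nonneg hyp.1 ht.1.le
      have b2 := ell_bound hyt0 (hyt.trans hyp.2)
      have b3 : (y * t) ^ 2 ≤ y ^ 2 := pow_le_pow_left₀ hyt0 hyt 2
      have b4 : t * (-Real.log (1 - y) - y) ≤ (-Real.log (1 - y) - y) := mul_le_of_le_one_left b1.1 ht.2
      have b5 : 0 ≤ t * (-Real.log (1 - y) - y) := mul_nonneg ht.1.le b1.1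
      rw [Real.norm_eq_abs, abs_le]
      constructor <;> linarith [b1.1, b1.2, b2.1, b2.2]
  rw [tsum_zero] at hd
  have := hd.add hz
  rw [add_zero] at this
  refine this.congr' ?_
  filter_upwards [self_mem_nhdsWithin] with σ hσ
  rw [(hsum σ hσ).tsum_sub (log_zeta hσ).2.summable, (log_zeta hσ).2.tsum_eq]
  ring

noncomputable def primesLt (z : ℝ) : Finset ℕ := (Finset.range ⌈z⌉₊).filter Nat.Prime

lemma mem_primesLt {z : ℝ} {p : ℕ} : p ∈ primesLt z ↔ p.Prime ∧ (p : ℝ) < z := by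
  simp [primesLt, Nat.lt_ceil, and_comm]

/-- Mertens' third theorem. -/
theorem mertens_third : Tendsto (fun z : ℝ => (∏ p ∈ primesLt z, (1 - 1 / (p : ℝ))) * Real.log z)
    atTop (𝓝 (Real.exp (-Real.eulerMascheroniConstant))) := by
  have h := (prime_meas.tauberian harm_meas harm_tend).comp Real.tendsto_log_atTop
  have h2 := (Real.continuous_exp.tendsto _).comp h.neg
  refine h2.congr' ?_
  filter_upwards [eventually_gt_atTop 1] with z hz
  have hl : 0 < Real.log z := Real.log_pos hz
  have hpos : ∀ p ∈ primesLt z, (1 - 1 / (p : ℝ)) ≠ 0 := by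
    intro p hp
    have h1 : (1 : ℝ) < p := by exact_mod_cast (mem_primesLt.1 hp).1.one_lt
    have : 1 / (p : ℝ) < 1 := by rw [div_lt_one (by linarith)]; exact h1
    linarith
  have hpos' : 0 < ∏ p ∈ primesLt z, (1 - 1 / (p : ℝ)) := by
    refine Finset.prod_pos fun p hp => ?_
    have h1 : (1 : ℝ) < p := by exact_mod_cast (mem_primesLt.1 hp).1.one_lt
    have : 1 / (p : ℝ) < 1 := by rw [div_lt_one (by linarith)]; exact h1
    linarith
  have e : LTr (fun p : Nat.Primes => -Real.log (1 - 1 / ((p : ℕ) : ℝ)))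
      (fun p : Nat.Primes => Real.log ((p : ℕ) : ℝ)) (Real.log z) =
      - Real.log (∏ p ∈ primesLt z, (1 - 1 / (p : ℝ))) := by
    rw [Real.log_prod hpos, ← Finset.sum_neg_distrib]
    unfold LTr
    have hiff : ∀ p : Nat.Primes, Real.log ((p : ℕ) : ℝ) < Real.log z ↔ ((p : ℕ) : ℝ) < z := by
      intro p
      exact Real.log_lt_log_iff (by exact_mod_cast p.2.pos) (by linarith)
    simp only [hiff]
    rw [tsum_eq_sum (β := Nat.Primes) (s := ((primesLt z).subtype Nat.Prime : Finset (Subtype Nat.Prime)))]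
    · rw [← Finset.sum_subtype_of_mem (p := Nat.Prime) (fun p : ℕ => -Real.log (1 - 1 / (p : ℝ)))
        (fun p hp => (mem_primesLt.1 hp).1)]
      refine Finset.sum_congr rfl fun p hp => ?_
      exact if_pos (mem_primesLt.1 (Finset.mem_subtype.1 hp)).2
    · intro p hp
      rw [if_neg]
      exact fun h => hp (Finset.mem_subtype.2 (mem_primesLt.2 ⟨p.2, h⟩))
  simp only [Function.comp]
  rw [e, neg_sub, sub_neg_eq_add, Real.exp_add, Real.exp_log hl, Real.exp_log hpos', mul_comm]

noncomputable def oddLt (z : ℝ) : Finset ℕ := (primesLt z).filter (fun p => 2 < p)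

lemma mem_oddLt {z : ℝ} {p : ℕ} : p ∈ oddLt z ↔ (p.Prime ∧ (p : ℝ) < z) ∧ 2 < p := by
  simp [oddLt, mem_primesLt]

lemma twin_tend :
    0 < (∏' p : {p : ℕ // p.Prime ∧ 2 < p}, (1 - 1 / (((p : ℕ) : ℝ) - 1) ^ 2)) ∧
    Tendsto (fun z : ℝ => ∏ p ∈ oddLt z, (1 - 1 / ((p : ℝ) - 1) ^ 2)) atTop
      (𝓝 (∏' p : {p : ℕ // p.Prime ∧ 2 < p}, (1 - 1 / (((p : ℕ) : ℝ) - 1) ^ 2))) := by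
  have h3 : ∀ p : {p : ℕ // p.Prime ∧ 2 < p}, (3 : ℝ) ≤ ((p : ℕ) : ℝ) := fun p => by
    exact_mod_cast p.2.2
  have hpos : ∀ p : {p : ℕ // p.Prime ∧ 2 < p}, 0 < (1 - 1 / (((p : ℕ) : ℝ) - 1) ^ 2) := by
    intro p
    have : 1 / (((p : ℕ) : ℝ) - 1) ^ 2 < 1 := by
      rw [div_lt_one (by nlinarith [h3 p])]
      nlinarith [h3 p]
    linarith
  have hs : Summable (fun p : {p : ℕ // p.Prime ∧ 2 < p} => -(1 / (((p : ℕ) : ℝ) - 1) ^ 2)) := by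
    have h0 : Summable (fun n : ℕ => 1 / (n : ℝ) ^ 2) := Real.summable_one_div_nat_pow.2 (by norm_num)
    have h1 : Summable (fun p : {p : ℕ // p.Prime ∧ 2 < p} => 1 / ((p : ℕ) : ℝ) ^ 2) :=
      h0.comp_injective Subtype.val_injective
    refine (Summable.of_nonneg_of_le (fun p => by positivity) (fun p => ?_) (h1.mul_left 4)).neg
    rw [mul_one_div, div_le_div_iff₀ (by have := h3 p; nlinarith) (by have := h3 p; nlinarith)]
    have := h3 p
    nlinarith
  have hlog := Real.summable_log_one_add_of_summable hs
  simp only [← sub_eq_add_neg] at hlog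
  refine ⟨?_, ?_⟩
  · rw [← Real.rexp_tsum_eq_tprod hpos hlog]
    exact Real.exp_pos _
  · have hP := (Real.multipliable_of_summable_log hpos hlog).hasProd
    have ht : Tendsto (fun z : ℝ => (oddLt z).subtype (fun p => p.Prime ∧ 2 < p)) atTop atTop := by
      refine tendsto_atTop_finset_of_monotone ?_ ?_
      · intro z w hzw p hp
        rw [Finset.mem_subtype, mem_oddLt] at *
        exact ⟨⟨hp.1.1, lt_of_lt_of_le hp.1.2 hzw⟩, hp.2⟩
      · intro p
        refine ⟨((p : ℕ) : ℝ) + 1, ?_⟩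
        rw [Finset.mem_subtype, mem_oddLt]
        exact ⟨⟨p.2.1, by linarith⟩, p.2.2⟩
    have h4 : Tendsto (fun s : Finset {p : ℕ // p.Prime ∧ 2 < p} =>
      ∏ p ∈ s, (1 - 1 / (((p : ℕ) : ℝ) - 1) ^ 2)) atTop _ := hP
    refine (h4.comp ht).congr fun z => ?_
    simp only [Function.comp]
    exact Finset.prod_subtype_of_mem (p := fun p : ℕ => p.Prime ∧ 2 < p)
      (fun p : ℕ => (1 - 1 / ((p : ℝ) - 1) ^ 2))
      (fun p hp => ⟨(mem_oddLt.1 hp).1.1, (mem_oddLt.1 hp).2⟩)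

noncomputable def bigP (N : ℕ) (z : ℝ) : Finset ℕ :=
  (N.primeFactors.filter (fun p => 2 < p)).filter (fun p : ℕ => ¬ (p : ℝ) < z)

noncomputable def bigR (N : ℕ) (z : ℝ) : ℝ :=
  ∏ p ∈ bigP N z, ((p : ℝ) - 1) / ((p : ℝ) - 2)

lemma bigR_bound {N : ℕ} (hN : 0 < N) {z α : ℝ} (hz : 2 < z)
    (h : Real.log N ≤ 2 * α * Real.log z) :
    1 ≤ bigR N z ∧ bigR N z ≤ Real.exp (2 * α / (z - 2)) := by
  have hmem : ∀ p ∈ bigP N z, z ≤ (p : ℝ) := by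
    intro p hp
    simp only [bigP, Finset.mem_filter, not_lt] at hp
    exact hp.2
  have hcard : ((bigP N z).card : ℝ) ≤ 2 * α := by
    have h1 : z ^ (bigP N z).card ≤ ∏ p ∈ bigP N z, (p : ℝ) := by
      rw [← Finset.prod_const]
      exact Finset.prod_le_prod (fun _ _ => by linarith) hmem
    have h2 : (∏ p ∈ bigP N z, p) ≤ N := by
      refine Nat.le_of_dvd hN ((Finset.prod_dvd_prod_of_subset _ _ _ ?_).trans (Nat.prod_primeFactors_dvd N))
      exact (Finset.filter_subset _ _).trans (Finset.filter_subset _ _)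
    have h3 : z ^ (bigP N z).card ≤ (N : ℝ) := by
      refine h1.trans ?_
      have h2' : ((∏ p ∈ bigP N z, p : ℕ) : ℝ) ≤ (N : ℝ) := Nat.cast_le.2 h2
      rwa [Nat.cast_prod] at h2'
    have h4 := Real.log_le_log (by positivity) h3
    rw [Real.log_pow] at h4
    exact le_of_mul_le_mul_right (h4.trans h) (Real.log_pos (by linarith))
  constructor
  · have h0 : ∏ _p ∈ bigP N z, (1 : ℝ) ≤ bigR N z := by
      refine Finset.prod_le_prod (fun _ _ => zero_le_one) (fun p hp => ?_)
      rw [le_div_iff₀ (by linarith [hmem p hp])]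
      linarith
    simpa using h0
  · calc bigR N z ≤ ∏ p ∈ bigP N z, Real.exp (1 / (z - 2)) := by
          refine Finset.prod_le_prod (fun p hp => ?_) (fun p hp => ?_)
          · exact div_nonneg (by linarith [hmem p hp]) (by linarith [hmem p hp])
          · have h5 := hmem p hp
            have e : ((p : ℝ) - 1) / ((p : ℝ) - 2) = 1 / ((p : ℝ) - 2) + 1 := by
              have : (p : ℝ) - 2 ≠ 0 := by linarith
              field_simp
              ring
            rw [e]
            refine le_trans ?_ (Real.add_one_le_exp _)
            have := one_div_le_one_div_of_le (show 0 < z - 2 by linarith) (show z - 2 ≤ (p : ℝ) - 2 by linarith)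
            linarith
      _ = Real.exp ((bigP N z).card * (1 / (z - 2))) := by
          rw [Finset.prod_const, Real.exp_nat_mul]
      _ ≤ _ := by
          rw [Real.exp_le_exp, mul_one_div]
          exact div_le_div_of_nonneg_right hcard (by linarith)

lemma WN_formula {N : ℕ} (hN : 0 < N) (he : Even N) {z : ℝ} (hz : 2 < z) :
    ∃ D : ℝ, 0 < D ∧
      WN N z * D = (∏ p ∈ oddLt z, (1 - 1 / ((p : ℝ) - 1) ^ 2)) *
        (2 * ∏ p ∈ primesLt z, (1 - 1 / (p : ℝ))) ∧
      CN N * D = bigR N z * ∏' p : {p : ℕ // p.Prime ∧ 2 < p}, (1 - 1 / (((p : ℕ) : ℝ) - 1) ^ 2) := by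
  classical
  have h3 : ∀ p : ℕ, 2 < p → (3 : ℝ) ≤ p := fun p hp => by exact_mod_cast hp
  have hset : (oddLt z).filter (fun p => p ∣ N) =
      (N.primeFactors.filter (fun p => 2 < p)).filter (fun p : ℕ => (p : ℝ) < z) := by
    ext p
    simp only [Finset.mem_filter, mem_oddLt, Nat.mem_primeFactors]
    constructor
    · rintro ⟨⟨⟨a, b⟩, c⟩, d⟩; exact ⟨⟨⟨a, d, hN.ne'⟩, c⟩, b⟩
    · rintro ⟨⟨⟨a, d, -⟩, c⟩, b⟩; exact ⟨⟨⟨a, b⟩, c⟩, d⟩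
  have hD : 0 < ∏ p ∈ (oddLt z).filter (fun p => p ∣ N), (1 - 1 / ((p : ℝ) - 1)) := by
    refine Finset.prod_pos fun p hp => ?_
    have := h3 p (mem_oddLt.1 (Finset.mem_filter.1 hp).1).2
    have h1 : 1 / ((p : ℝ) - 1) < 1 := by rw [div_lt_one (by linarith)]; linarith
    linarith
  refine ⟨_, hD, ?_, ?_⟩
  · have hW : WN N z = ∏ p ∈ (oddLt z).filter (fun p => ¬ p ∣ N), (1 - 1 / ((p : ℝ) - 1)) := by
      unfold WN
      rw [← finprod_mem_coe_finset]
      refine finprod_mem_congr (Set.ext fun p => ?_) (fun _ _ => rfl)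
      have : p ∈ {p : ℕ | p.Prime ∧ (p : ℝ) < z ∧ ¬ p ∣ N} ↔
          p ∈ (((oddLt z).filter (fun p => ¬ p ∣ N) : Finset ℕ) : Set ℕ) := by
        simp only [Set.mem_ofPred_eq, Finset.coe_filter, mem_oddLt]
        constructor
        · rintro ⟨a, b, c⟩
          refine ⟨⟨⟨a, b⟩, lt_of_le_of_ne a.two_le ?_⟩, c⟩
          rintro rfl
          exact c he.two_dvd
        · rintro ⟨⟨⟨a, b⟩, _⟩, c⟩
          exact ⟨a, b, c⟩
      exact this
    rw [hW, mul_comm, Finset.prod_filter_mul_prod_filter_not]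
    have hM : 2 * ∏ p ∈ primesLt z, (1 - 1 / (p : ℝ)) = ∏ p ∈ oddLt z, (1 - 1 / (p : ℝ)) := by
      have hins : primesLt z = insert 2 (oddLt z) := by
        ext p
        simp only [Finset.mem_insert, mem_primesLt, mem_oddLt]
        constructor
        · rintro ⟨a, b⟩
          rcases a.two_le.eq_or_lt with h | h
          · exact Or.inl h.symm
          · exact Or.inr ⟨⟨a, b⟩, h⟩
        · rintro (rfl | h)
          · exact ⟨Nat.prime_two, by exact_mod_cast hz⟩
          · exact h.1
      rw [hins, Finset.prod_insert (by simp [mem_oddLt])]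
      push_cast
      ring
    rw [hM, ← Finset.prod_mul_distrib]
    refine Finset.prod_congr rfl fun p hp => ?_
    have := h3 p (mem_oddLt.1 hp).2
    have h1 : (p : ℝ) - 1 ≠ 0 := by linarith
    have h2 : (p : ℝ) ≠ 0 := by linarith
    field_simp
    ring
  · unfold CN bigR bigP
    rw [← Finset.prod_filter_mul_prod_filter_not (N.primeFactors.filter (fun p => 2 < p))
      (fun p : ℕ => (p : ℝ) < z), hset]
    have hinv : (∏ p ∈ (N.primeFactors.filter (fun p => 2 < p)).filter (fun p : ℕ => (p : ℝ) < z),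
        ((p : ℝ) - 1) / ((p : ℝ) - 2)) *
        ∏ p ∈ (N.primeFactors.filter (fun p => 2 < p)).filter (fun p : ℕ => (p : ℝ) < z),
        (1 - 1 / ((p : ℝ) - 1)) = 1 := by
      rw [← Finset.prod_mul_distrib]
      refine Finset.prod_eq_one fun p hp => ?_
      have := h3 p (Finset.mem_filter.1 (Finset.mem_filter.1 hp).1).2
      have h1 : (p : ℝ) - 1 ≠ 0 := by linarith
      have h2 : (p : ℝ) - 2 ≠ 0 := by linarith
      field_simp
      ring
    linear_combination (∏ p ∈ (N.primeFactors.filter (fun p => 2 < p)).filter (fun p : ℕ => ¬ (p : ℝ) < z),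
        ((p : ℝ) - 1) / ((p : ℝ) - 2)) * (∏' p : {p : ℕ // p.Prime ∧ 2 < p}, (1 - 1 / (((p : ℕ) : ℝ) - 1) ^ 2)) * hinv

set_option maxHeartbeats 1600000 in
theorem W_asymptotic (α : ℝ) (hα : 1 ≤ α) :
    ∀ δ : ℝ, 0 < δ →
      ∃ ε : ℝ, 0 < ε ∧ ε < 1 / α ∧ ∃ N₀ : ℕ, ∀ N : ℕ, N₀ ≤ N → Even N →
        ∀ z : ℝ, (N : ℝ) ^ (1 / α - ε) < z → z ≤ (N : ℝ) ^ (1 / α) →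
          |WN N z * Real.log N /
              (2 * α * Real.exp (-Real.eulerMascheroniConstant) * CN N) - 1| ≤ δ := by
  intro δ hδ
  have hα0 : 0 < α := by linarith
  obtain ⟨hC, hT⟩ := twin_tend
  set C := ∏' p : {p : ℕ // p.Prime ∧ 2 < p}, (1 - 1 / (((p : ℕ) : ℝ) - 1) ^ 2) with hCdef
  set E := Real.exp (-Real.eulerMascheroniConstant) with hE
  have hE0 : 0 < E := Real.exp_pos _
  -- the main factor
  have hG : Tendsto (fun z : ℝ => ((∏ p ∈ oddLt z, (1 - 1 / ((p : ℝ) - 1) ^ 2)) / C) *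
      (((∏ p ∈ primesLt z, (1 - 1 / (p : ℝ))) * Real.log z) / E)) atTop (𝓝 1) := by
    have := (hT.div_const C).mul (mertens_third.div_const E)
    rwa [div_self hC.ne', div_self hE0.ne', one_mul] at this
  have hX : Tendsto (fun z : ℝ => Real.exp (-(2 * α / (z - 2)))) atTop (𝓝 1) := by
    have h1 : Tendsto (fun z : ℝ => z - 2) atTop atTop := tendsto_atTop_add_const_right _ _ tendsto_id
    have h2 := (h1.const_div_atTop (2 * α)).neg
    have h3 := (Real.continuous_exp.tendsto _).comp h2
    rw [neg_zero, Real.exp_zero] at h3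
    exact h3
  set t : ℝ := (2 + 2 * δ) / (2 + δ) with ht
  have ht1 : t < 1 + δ := by rw [ht, div_lt_iff₀ (by linarith)]; nlinarith
  have ht0 : 0 < t := by positivity
  set ε : ℝ := δ / (2 * α * (1 + δ)) with hε
  have hεα : 1 - ε * α = 1 / t := by rw [hε, ht]; field_simp; ring
  have hε2 : ε * α ≤ 1 / 2 := by
    have : ε * α = δ / (2 * (1 + δ)) := by rw [hε]; field_simp
    rw [this, div_le_div_iff₀ (by linarith) (by norm_num)]
    linarith
  have hεlt : ε < 1 / α := by rw [lt_div_iff₀ hα0]; linarith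
  refine ⟨ε, by positivity, hεlt, ?_⟩
  have hup := (hG.mul_const t).eventually_lt_const (show 1 * t < 1 + δ by linarith)
  have hlo := (hG.mul hX).eventually_const_lt (show 1 - δ < 1 * 1 by linarith)
  have hall := (hup.and hlo).and (eventually_gt_atTop (2 : ℝ))
  obtain ⟨z₀, hz₀⟩ := eventually_atTop.1 hall
  have hNt : Tendsto (fun N : ℕ => (N : ℝ) ^ (1 / α - ε)) atTop atTop :=
    (tendsto_rpow_atTop (by linarith)).comp tendsto_natCast_atTop_atTop
  obtain ⟨N₀, hN₀⟩ := eventually_atTop.1 ((hNt.eventually_ge_atTop z₀).and (eventually_gt_atTop 1))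
  refine ⟨N₀, fun N hN he z hz1 hz2 => ?_⟩
  obtain ⟨hNz, hN1⟩ := hN₀ N hN
  obtain ⟨⟨hu, hl⟩, hz3⟩ := hz₀ z (by linarith)
  have hNpos : (0 : ℝ) < N := by exact_mod_cast (by omega : 0 < N)
  have hlogN : 0 < Real.log N := Real.log_pos (by exact_mod_cast hN1)
  have hlogz : 0 < Real.log z := Real.log_pos (by linarith)
  have l1 : (1 / α - ε) * Real.log N ≤ Real.log z := by
    rw [← Real.log_rpow hNpos]
    exact Real.log_le_log (Real.rpow_pos_of_pos hNpos _) hz1.le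
  have l2 : Real.log z ≤ (1 / α) * Real.log N := by
    rw [← Real.log_rpow hNpos]
    exact Real.log_le_log (by linarith) hz2
  have l1' : (1 - ε * α) * Real.log N ≤ α * Real.log z := by
    have := mul_le_mul_of_nonneg_left l1 hα0.le
    have e : α * ((1 / α - ε) * Real.log N) = (1 - ε * α) * Real.log N := by field_simp
    linarith
  have l2' : α * Real.log z ≤ Real.log N := by
    have := mul_le_mul_of_nonneg_left l2 hα0.le
    have e : α * ((1 / α) * Real.log N) = Real.log N := by field_simp
    linarith
  have r1 : 1 ≤ Real.log N / (α * Real.log z) := by rw [le_div_iff₀ (by positivity)]; linarith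
  have r2 : Real.log N / (α * Real.log z) ≤ t := by
    rw [div_le_iff₀ (by positivity)]
    rw [hεα, one_div, inv_mul_le_iff₀ ht0] at l1'
    exact l1'
  obtain ⟨R1, R2⟩ := bigR_bound (N := N) (by omega) (α := α) hz3 (by nlinarith)
  obtain ⟨D, hD, eW, eC⟩ := WN_formula (N := N) (by omega) he hz3
  rw [← hCdef] at eC
  set P := ∏ p ∈ oddLt z, (1 - 1 / ((p : ℝ) - 1) ^ 2)
  set M := ∏ p ∈ primesLt z, (1 - 1 / (p : ℝ))
  set R := bigR N z
  have hR0 : 0 < R := by linarith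
  have eW' : WN N z = P * (2 * M) / D := by rw [← eW]; field_simp
  have eC' : CN N = R * C / D := by rw [← eC]; field_simp
  have key : WN N z * Real.log N / (2 * α * E * CN N) =
      (P / C * (M * Real.log z / E)) * (Real.log N / (α * Real.log z)) * R⁻¹ := by
    rw [eW', eC']
    field_simp
  rw [key]
  have hP0 : 0 < P := by
    refine Finset.prod_pos fun p hp => ?_
    have h3 : (3 : ℝ) ≤ p := by exact_mod_cast (mem_oddLt.1 hp).2
    have : 1 / ((p : ℝ) - 1) ^ 2 < 1 := by
      rw [div_lt_one (by nlinarith)]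
      nlinarith
    linarith
  have hM0 : 0 < M := by
    refine Finset.prod_pos fun p hp => ?_
    have h1 : (1 : ℝ) < p := by exact_mod_cast (mem_primesLt.1 hp).1.one_lt
    have : 1 / (p : ℝ) < 1 := by rw [div_lt_one (by linarith)]; exact h1
    linarith
  have hG0 : 0 < P / C * (M * Real.log z / E) :=
    mul_pos (div_pos hP0 hC) (div_pos (mul_pos hM0 hlogz) hE0)
  generalize P / C * (M * Real.log z / E) = G at hG0 hu hl ⊢
  have i1 : R⁻¹ ≤ 1 := inv_le_one_of_one_le₀ R1
  have i2 : Real.exp (-(2 * α / (z - 2))) ≤ R⁻¹ := by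
    rw [Real.exp_neg]
    exact inv_anti₀ hR0 R2
  have i0 : 0 < R⁻¹ := inv_pos.2 hR0
  have u1 : G * (Real.log N / (α * Real.log z)) * R⁻¹ ≤ G * t :=
    calc _ ≤ G * (Real.log N / (α * Real.log z)) * 1 := mul_le_mul_of_nonneg_left i1 (mul_nonneg hG0.le (by linarith))
      _ ≤ G * t := by rw [mul_one]; exact mul_le_mul_of_nonneg_left r2 hG0.le
  have u2 : G * Real.exp (-(2 * α / (z - 2))) ≤ G * (Real.log N / (α * Real.log z)) * R⁻¹ :=
    calc _ ≤ G * R⁻¹ := mul_le_mul_of_nonneg_left i2 hG0.le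
      _ ≤ _ := mul_le_mul_of_nonneg_right (le_mul_of_one_le_right hG0.le r1) i0.le
  rw [abs_le]
  constructor <;> linarith
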